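/- For every nonnegative integer n and every integer k ≥ 2, a̅₅(5^k·n) = ((5^k − 1)/4)·a̅₅(5n) − ((5^k − 5)/4)·a̅₅(n). -/

import Mathlib

open scoped BigOperators

/-- The q-Pochhammer infinite product `(a; q)_∞ = ∏_{k≥0} (1 - a q^k)`. -/
noncomputable def qpoch (a q : ℂ) : ℂ := ∏' k : ℕ, (1 - a * q ^ k)

/-- `φ(-q) = (q;q)_∞² / (q²;q²)_∞`. -/
noncomputable def phiNeg (q : ℂ) : ℂ := qpoch q q ^ 2 / qpoch (q ^ 2) (q ^ 2)

/-- `ψ(-q) = (q;q)_∞ (q⁴;q⁴)_∞ / (q²;q²)_∞`. -/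
noncomputable def psiNeg (q : ℂ) : ℂ :=
  qpoch q q * qpoch (q ^ 4) (q ^ 4) / qpoch (q ^ 2) (q ^ 2)

theorem cyc_prod (w x : ℂ) (h : 1 + w + w^2 + w^3 + w^4 = 0) :
    (1 - x) * (1 - w * x) * (1 - w^2 * x) * (1 - w^3 * x) * (1 - w^4 * x) = 1 - x^5 := by
  have h5 : w^5 = 1 := by linear_combination (w - 1) * h
  have h14 : (1 - w * x) * (1 - w^4 * x) = 1 - (w + w^4) * x + x^2 := by
    linear_combination x^2 * h5
  have h23 : (1 - w^2 * x) * (1 - w^3 * x) = 1 - (w^2 + w^3) * x + x^2 := by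
    linear_combination x^2 * h5
  have hs : w + w^4 = -1 - (w^2 + w^3) := by linear_combination h
  have hst : (w^2 + w^3)^2 = 1 - (w^2 + w^3) := by
    linear_combination (w + 2) * h5 + h
  calc _ = (1 - x) * ((1 - w * x) * (1 - w^4 * x)) * ((1 - w^2 * x) * (1 - w^3 * x)) := by ring
    _ = _ := by
      rw [h14, h23, hs]
      linear_combination (-(1 - x) * x^2) * hst

section alg
variable (w A B C : ℂ) (h : 1 + w + w^2 + w^3 + w^4 = 0)

theorem alg_e1 (h : 1 + w + w^2 + w^3 + w^4 = 0) :
    (A + B + C) + (A + w * B + w^4 * C) + (A + w^2 * B + (w^2)^4 * C)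
      + (A + w^3 * B + (w^3)^4 * C) + (A + w^4 * B + (w^4)^4 * C) = 5 * A := by
  have h5 : w^5 = 1 := by linear_combination (w - 1) * h
  grind

theorem alg_p3 (h : 1 + w + w^2 + w^3 + w^4 = 0) :
    (A + B + C)^3 + (A + w * B + w^4 * C)^3 + (A + w^2 * B + (w^2)^4 * C)^3
      + (A + w^3 * B + (w^3)^4 * C)^3 + (A + w^4 * B + (w^4)^4 * C)^3 = 5 * (A^3 + 6 * A * (B * C)) := by
  have h5 : w^5 = 1 := by linear_combination (w - 1) * h
  have h2 : (w^2)^4 = w^3 := by linear_combination w^3 * h5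
  have h3 : (w^3)^4 = w^2 := by linear_combination (w^7 + w^2) * h5
  have h4 : (w^4)^4 = w := by linear_combination (w^11 + w^6 + w) * h5
  rw [h2, h3, h4]
  grind

theorem alg_e4 (h : 1 + w + w^2 + w^3 + w^4 = 0) (y0 y1 y2 y3 y4 : ℂ)
    (h0 : y0 = A + B + C) (h1 : y1 = A + w * B + w^4 * C) (h2 : y2 = A + w^2 * B + (w^2)^4 * C)
    (h3 : y3 = A + w^3 * B + (w^3)^4 * C) (h4 : y4 = A + w^4 * B + (w^4)^4 * C) :
    y1 * y2 * y3 * y4 + y0 * y2 * y3 * y4 + y0 * y1 * y3 * y4 + y0 * y1 * y2 * y4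
     + y0 * y1 * y2 * y3 = 5 * (A^4 - 3 * A^2 * (B * C) + (B * C)^2) := by
  have h5 : w^5 = 1 := by linear_combination (w - 1) * h
  have e2 : (w^2)^4 = w^3 := by linear_combination w^3 * h5
  have e3 : (w^3)^4 = w^2 := by linear_combination (w^7 + w^2) * h5
  have e4 : (w^4)^4 = w := by linear_combination (w^11 + w^6 + w) * h5
  rw [e2] at h2
  rw [e3] at h3
  rw [e4] at h4
  have hs : w + w^4 = -1 - (w^2 + w^3) := by linear_combination h
  have hst : (w^2 + w^3)^2 = 1 - (w^2 + w^3) := by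
    linear_combination (w + 2) * h5 + h
  generalize ht : w^2 + w^3 = t at *
  have p14 : y1 * y4 = A^2 + B^2 + C^2 + (-1 - t) * (A * B + A * C) + t * (B * C) := by
    rw [h1, h4, ← hs, ← ht]
    linear_combination (B^2 + C^2 + w^3 * (B * C)) * h5
  have p23 : y2 * y3 = A^2 + B^2 + C^2 + t * (A * B + A * C) + (-1 - t) * (B * C) := by
    rw [h2, h3, ← hs, ← ht]
    linear_combination (B^2 + C^2 + w * (B * C)) * h5
  have s14 : y1 + y4 = 2 * A + (-1 - t) * (B + C) := by
    rw [h1, h4, ← hs]; ring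
  have s23 : y2 + y3 = 2 * A + t * (B + C) := by
    rw [h2, h3, ← ht]; ring
  calc _ = (y1 * y4) * (y2 * y3) + y0 * ((y1 + y4) * (y2 * y3) + (y2 + y3) * (y1 * y4)) := by ring
    _ = _ := by
      rw [p14, p23, s14, s23, h0]
      clear p14 p23 s14 s23 h0 h1 h2 h3 h4 h5 e2 e3 e4 ht hs h
      grind
end alg

theorem coeff_zero (c : ℕ → ℂ) (hs : ∀ q : ℂ, ‖q‖ < 1 → HasSum (fun n => c n * q ^ n) 0) :
    ∀ n, c n = 0 := by
  have key : HasFPowerSeriesAt (0 : ℂ → ℂ) (FormalMultilinearSeries.ofScalars ℂ c) 0 := by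
    rw [hasFPowerSeriesAt_iff]
    have : Metric.ball (0:ℂ) 1 ∈ nhds (0:ℂ) := Metric.ball_mem_nhds _ one_pos
    filter_upwards [this] with z hz
    have := hs z (by simpa using hz)
    simpa [mul_comm, FormalMultilinearSeries.coeff_ofScalars] using this
  intro n
  have := key.eq_zero
  have h2 : (FormalMultilinearSeries.ofScalars ℂ c).coeff n = 0 := by rw [this]; rfl
  simpa [FormalMultilinearSeries.coeff_ofScalars] using h2

theorem geom_w {w : ℂ} (hw : IsPrimitiveRoot w 5) : 1 + w + w^2 + w^3 + w^4 = 0 := by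
  have := hw.geom_sum_eq_zero (by norm_num)
  simpa [Finset.sum_range_succ] using this

theorem section5 {w : ℂ} (hw : IsPrimitiveRoot w 5) (b : ℕ → ℂ)
    (hs : ∀ q : ℂ, ‖q‖ < 1 → Summable (fun n => b n * q ^ n)) (q : ℂ) (hq : ‖q‖ < 1) :
    HasSum (fun n => b (5 * n) * (q^5)^n)
      ((∑ j ∈ Finset.range 5, ∑' n, b n * (w^j * q)^n) / 5) := by
  have hw1 : ‖w‖ = 1 := hw.norm'_eq_one (by norm_num)
  have h1 : ∀ j ∈ Finset.range 5, HasSum (fun n => b n * (w^j * q)^n) (∑' n, b n * (w^j * q)^n) := by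
    intro j _
    exact (hs _ (by simpa [hw1] using hq)).hasSum
  have h2 := (hasSum_sum h1).div_const 5
  have hinj : Function.Injective (fun n : ℕ => 5 * n) := fun a b h => by simpa using h
  have h3 : (fun n => b (5 * n) * (q^5)^n) =
    (fun n => (∑ j ∈ Finset.range 5, b n * (w^j * q)^n) / 5) ∘ (fun n : ℕ => 5 * n) := by
    funext n
    have : ∀ j, (w^j)^(5*n) = 1 := by
      intro j
      rw [← pow_mul, show j * (5 * n) = 5 * (j * n) by ring, pow_mul, hw.pow_eq_one, one_pow]
    simp only [Function.comp, mul_pow, this]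
    simp [pow_mul]
  rw [h3, hinj.hasSum_iff]
  · exact h2
  · intro n hn
    have h5 : ¬ 5 ∣ n := fun ⟨k, hk⟩ => hn ⟨k, hk.symm⟩
    have hp : IsPrimitiveRoot (w^n) 5 :=
      hw.pow_of_coprime n (((Nat.Prime.coprime_iff_not_dvd (by norm_num)).2 h5).symm)
    have := hp.geom_sum_eq_zero (by norm_num)
    have h6 : ∑ j ∈ Finset.range 5, b n * (w^j * q)^n
        = b n * q^n * ∑ j ∈ Finset.range 5, (w^n)^j := by
      rw [Finset.mul_sum]
      refine Finset.sum_congr rfl fun j _ => ?_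
      rw [mul_pow, ← pow_mul, ← pow_mul, mul_comm j n]; ring
    rw [h6, this]; simp

theorem qpoch_eq (q : ℂ) : qpoch q q = ∏' k : ℕ, (1 - q ^ (k + 1)) := by
  unfold qpoch
  congr 1; funext k; rw [pow_succ']

theorem summ_pow {q : ℂ} (hq : ‖q‖ < 1) : Summable (fun k : ℕ => ‖-q ^ (k + 1)‖) := by
  have := (summable_nat_add_iff 1).2 (summable_geometric_of_lt_one (norm_nonneg q) hq)
  simpa [norm_neg, norm_pow] using this

theorem mult_E {q : ℂ} (hq : ‖q‖ < 1) : Multipliable (fun k : ℕ => 1 - q ^ (k + 1)) := by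
  simpa [sub_eq_add_neg] using multipliable_one_add_of_summable (summ_pow hq)

theorem one_sub_ne {q : ℂ} (hq : ‖q‖ < 1) (k : ℕ) : 1 - q ^ (k + 1) ≠ 0 := by
  intro h
  have h1 : ‖q ^ (k + 1)‖ = 1 := by rw [← sub_eq_zero.1 h]; simp
  have h2 : ‖q ^ (k + 1)‖ < 1 := by
    rw [norm_pow]; exact pow_lt_one₀ (norm_nonneg _) hq (by simp)
  linarith

theorem one_add_ne {q : ℂ} (hq : ‖q‖ < 1) (k : ℕ) : 1 + q ^ (k + 1) ≠ 0 := by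
  intro h
  have h1 : ‖q ^ (k + 1)‖ = 1 := by
    rw [← norm_neg, ← eq_neg_of_add_eq_zero_left h]; simp
  have h2 : ‖q ^ (k + 1)‖ < 1 := by
    rw [norm_pow]; exact pow_lt_one₀ (norm_nonneg _) hq (by simp)
  linarith

theorem E_ne {q : ℂ} (hq : ‖q‖ < 1) : qpoch q q ≠ 0 := by
  rw [qpoch_eq]
  simpa [sub_eq_add_neg] using tprod_one_add_ne_zero_of_summable
    (f := fun k : ℕ => -q ^ (k + 1)) (fun k => by simpa [sub_eq_add_neg] using one_sub_ne hq k)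
    (summ_pow hq)

theorem npow_lt {q : ℂ} (hq : ‖q‖ < 1) {m : ℕ} (hm : m ≠ 0) : ‖q ^ m‖ < 1 := by
  rw [norm_pow]; exact pow_lt_one₀ (norm_nonneg _) hq hm

theorem phiNeg_ne {q : ℂ} (hq : ‖q‖ < 1) : phiNeg q ≠ 0 :=
  div_ne_zero (pow_ne_zero _ (E_ne hq)) (E_ne (npow_lt hq (by norm_num)))

theorem hasProd_ite (f : ℕ → ℂ) (c : ℂ) :
    HasProd (fun k : ℕ => if 5 ∣ k + 1 then f (k + 1) else 1) c ↔
      HasProd (fun m : ℕ => f (5 * (m + 1))) c := by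
  have hinj : Function.Injective (fun m : ℕ => 5 * m + 4) := fun a b h => by simpa using h
  rw [← hinj.hasProd_iff]
  · have : ((fun k : ℕ => if 5 ∣ k + 1 then f (k + 1) else 1) ∘ fun m : ℕ => 5 * m + 4)
        = (fun m : ℕ => f (5 * (m + 1))) := by
      funext m
      have h1 : 5 * m + 4 + 1 = 5 * (m + 1) := by ring
      simp [Function.comp, h1]
    rw [this]
  · intro k hk
    have : ¬ 5 ∣ k + 1 := by
      rintro ⟨m, hm⟩
      exact hk ⟨m - 1, by simp only; omega⟩
    simp [this]

theorem E_hasProd {q : ℂ} (hq : ‖q‖ < 1) : HasProd (fun k : ℕ => 1 - q ^ (k + 1)) (qpoch q q) := by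
  rw [qpoch_eq]; exact (mult_E hq).hasProd

theorem E_prod {w : ℂ} (hw : IsPrimitiveRoot w 5) {q : ℂ} (hq : ‖q‖ < 1) :
    (∏ j ∈ Finset.range 5, qpoch (w^j * q) (w^j * q)) * qpoch (q^25) (q^25)
      = qpoch (q^5) (q^5) ^ 6 := by
  have hw1 : ‖w‖ = 1 := hw.norm'_eq_one (by norm_num)
  have h1 : HasProd (fun k : ℕ => ∏ j ∈ Finset.range 5, (1 - (w^j * q) ^ (k + 1)))
      (∏ j ∈ Finset.range 5, qpoch (w^j * q) (w^j * q)) :=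
    hasProd_prod fun j _ => E_hasProd (by simpa [hw1] using hq)
  have h5 := E_hasProd (npow_lt hq (m := 5) (by norm_num))
  have h25 := E_hasProd (npow_lt hq (m := 25) (by norm_num))
  have h2 : HasProd (fun k : ℕ => if 5 ∣ k + 1 then 1 - (q^5) ^ (k + 1) else 1)
      (qpoch (q^25) (q^25)) := by
    refine (hasProd_ite (fun k => 1 - (q^5)^k) _).2 ?_
    refine h25.congr_fun ?_
    intro m; simp only [← pow_mul]; ring_nf
  have h3 : HasProd (fun k : ℕ => if 5 ∣ k + 1 then 1 - q ^ (k + 1) else 1)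
      (qpoch (q^5) (q^5)) := by
    refine (hasProd_ite (fun k => 1 - q^k) _).2 ?_
    refine h5.congr_fun ?_
    intro m; simp only [← pow_mul]
  have hL := h1.mul h2
  have hR := h5.mul (h3.mul (h3.mul (h3.mul (h3.mul h3))))
  have : qpoch (q^5) (q^5) ^ 6 = qpoch (q^5) (q^5) * (qpoch (q^5) (q^5) * (qpoch (q^5) (q^5) *
    (qpoch (q^5) (q^5) * (qpoch (q^5) (q^5) * qpoch (q^5) (q^5))))) := by ring
  rw [this]
  refine hL.unique (hR.congr_fun ?_)
  intro k
  by_cases hk : 5 ∣ k + 1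
  · have : ∀ j, (w^j)^(k+1) = 1 := by
      intro j
      obtain ⟨m, hm⟩ := hk
      rw [hm, ← pow_mul, show j * (5 * m) = 5 * (j * m) by ring, pow_mul, hw.pow_eq_one, one_pow]
    simp only [if_pos hk, mul_pow, this]
    simp; ring
  · have hp : IsPrimitiveRoot (w^(k+1)) 5 :=
      hw.pow_of_coprime _ (((Nat.Prime.coprime_iff_not_dvd (by norm_num)).2 hk).symm)
    have := cyc_prod (w^(k+1)) (q^(k+1)) (geom_w hp)
    simp only [if_neg hk, mul_one, Finset.prod_range_succ, Finset.prod_range_zero, one_mul]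
    rw [← pow_mul q 5, mul_comm 5, pow_mul, ← this]
    ring

theorem phi_prod {w : ℂ} (hw : IsPrimitiveRoot w 5) {q : ℂ} (hq : ‖q‖ < 1) :
    (∏ j ∈ Finset.range 5, phiNeg (w^j * q)) = phiNeg (q^5) ^ 6 / phiNeg (q^25) := by
  have hw2 : IsPrimitiveRoot (w^2) 5 := hw.pow_of_coprime _ (by norm_num)
  have e1 := E_prod hw hq
  have e2 := E_prod hw2 (npow_lt hq (m := 2) (by norm_num))
  have n25 := E_ne (npow_lt hq (m := 25) (by norm_num))
  have n5 := E_ne (npow_lt hq (m := 5) (by norm_num))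
  have n50 := E_ne (npow_lt (npow_lt hq (m := 25) (by norm_num)) (m := 2) (by norm_num))
  have n10 := E_ne (npow_lt (npow_lt hq (m := 5) (by norm_num)) (m := 2) (by norm_num))
  unfold phiNeg
  rw [Finset.prod_div_distrib, Finset.prod_pow]
  have e3 : ∀ j ∈ Finset.range 5, qpoch ((w^j*q)^2) ((w^j*q)^2) =
     qpoch ((w^2)^j*q^2) ((w^2)^j*q^2) := by
    intro j _
    rw [mul_pow, ← pow_mul, ← pow_mul, mul_comm j 2]
  rw [Finset.prod_congr rfl e3]
  rw [← pow_mul q 2 25, mul_comm 2 25, pow_mul, ← pow_mul q 2 5, mul_comm 2 5, pow_mul q 5 2] at e2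
  rw [eq_div_of_mul_eq n25 e1, eq_div_of_mul_eq n50 e2]
  field_simp

/-- theta series over the integers -/
noncomputable def TT (x : ℂ) : ℂ := ∑' n : ℤ, x ^ (n.natAbs ^ 2)

theorem summ_TT {x : ℂ} (hx : ‖x‖ < 1) : Summable (fun n : ℤ => ‖x ^ (n.natAbs ^ 2)‖) := by
  have h : Summable (fun n : ℕ => ‖x ^ (n ^ 2)‖) := by
    refine Summable.of_nonneg_of_le (fun _ => norm_nonneg _) (fun n => ?_)
      (summable_geometric_of_lt_one (norm_nonneg x) hx)
    rw [norm_pow]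
    exact pow_le_pow_of_le_one (norm_nonneg _) hx.le (Nat.le_self_pow (by norm_num) n)
  refine Summable.of_nat_of_neg ?_ ?_
  · simpa using h
  · simpa using h

noncomputable def PP (q : ℂ) (n : ℕ) : ℂ :=
  (∏ j ∈ Finset.range n, (1 - q ^ (j + 1))) ^ 2 / ∏ j ∈ Finset.range n, (1 - (q ^ 2) ^ (j + 1))

noncomputable def UU (q : ℂ) (n : ℕ) : ℂ := 2 / (PP q n * (1 + q ^ n))

theorem PP_ne {q : ℂ} (hq : ‖q‖ < 1) (n : ℕ) : PP q n ≠ 0 := by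
  unfold PP
  refine div_ne_zero (pow_ne_zero _ (Finset.prod_ne_zero_iff.2 fun j _ => one_sub_ne hq j))
    (Finset.prod_ne_zero_iff.2 fun j _ => one_sub_ne (npow_lt hq (by norm_num)) j)

theorem PP_succ {q : ℂ} (hq : ‖q‖ < 1) (n : ℕ) :
    PP q (n + 1) * (1 + q ^ (n + 1)) = PP q n * (1 - q ^ (n + 1)) := by
  have h1 := one_sub_ne hq n
  have h2 := one_add_ne hq n
  have h3 : (∏ j ∈ Finset.range n, (1 - (q ^ 2) ^ (j + 1))) ≠ 0 :=
    Finset.prod_ne_zero_iff.2 fun j _ => one_sub_ne (npow_lt hq (by norm_num)) j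
  unfold PP
  rw [Finset.prod_range_succ, Finset.prod_range_succ]
  have h4 : 1 - (q ^ 2) ^ (n + 1) = (1 - q ^ (n + 1)) * (1 + q ^ (n + 1)) := by
    rw [← pow_mul, mul_comm, pow_mul]; ring
  rw [h4]
  field_simp

theorem one_add_ne' {q : ℂ} (hq : ‖q‖ < 1) (k : ℕ) : 1 + q ^ k ≠ 0 := by
  cases k with
  | zero => norm_num
  | succ k => exact one_add_ne hq k

theorem UU_succ {q : ℂ} (hq : ‖q‖ < 1) (n : ℕ) :
    UU q (n + 1) * (1 - q ^ (n + 1)) = UU q n * (1 + q ^ n) := by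
  unfold UU
  rw [PP_succ hq]
  have h1 := one_sub_ne hq n
  have h2 := one_add_ne' hq n
  have h3 := PP_ne hq n
  field_simp

theorem tele {q : ℂ} (hq : ‖q‖ < 1) (n m : ℕ) :
    PP q (n + 1) * ∑ j ∈ Finset.range m, (-1) ^ j * UU q j * q ^ (j * (n + 2))
      - PP q n * ∑ j ∈ Finset.range m, (-1) ^ j * UU q j * q ^ (j * (n + 1))
    = PP q n / (1 + q ^ (n + 1)) * ((-1) ^ m * UU q m * (1 - q ^ m) * q ^ (m * (n + 1))) := by
  have h2 := one_add_ne hq n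
  have hP : PP q (n + 1) = PP q n * (1 - q ^ (n + 1)) / (1 + q ^ (n + 1)) := by
    rw [← PP_succ hq]; field_simp
  induction m with
  | zero => simp
  | succ m ih =>
    rw [Finset.sum_range_succ, Finset.sum_range_succ]
    have hu := UU_succ hq m
    have e1 : q ^ (m * (n + 2)) = q ^ (m * (n + 1)) * q ^ m := by rw [← pow_add]; ring_nf
    have e2 : q ^ ((m + 1) * (n + 1)) = q ^ (m * (n + 1)) * q ^ (n + 1) := by
      rw [← pow_add]; ring_nf
    have e3 : (-1 : ℂ) ^ (m + 1) * UU q (m + 1) * (1 - q ^ (m + 1)) * q ^ ((m + 1) * (n + 1))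
        = -((-1) ^ m * (UU q m * (1 + q ^ m)) * (q ^ (m * (n + 1)) * q ^ (n + 1))) := by
      rw [← hu, e2]; ring
    rw [e3, e1]
    have step : PP q (n + 1) * ((-1) ^ m * UU q m * (q ^ (m * (n + 1)) * q ^ m))
        - PP q n * ((-1) ^ m * UU q m * q ^ (m * (n + 1)))
        = PP q n / (1 + q ^ (n + 1)) *
            -((-1) ^ m * (UU q m * (1 + q ^ m)) * (q ^ (m * (n + 1)) * q ^ (n + 1)))
          - PP q n / (1 + q ^ (n + 1)) * ((-1) ^ m * UU q m * (1 - q ^ m) * q ^ (m * (n + 1))) := by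
      rw [hP]
      generalize q ^ (m * (n + 1)) = z at *
      field_simp
      ring
    linear_combination ih + step

theorem Icc_step (n : ℕ) (f : ℤ → ℂ) :
    ∑ k ∈ Finset.Icc (-((n + 1 : ℕ) : ℤ)) ((n + 1 : ℕ) : ℤ), f k
      = ∑ k ∈ Finset.Icc (-(n : ℤ)) (n : ℤ), f k + (f ((n + 1 : ℕ) : ℤ) + f (-((n + 1 : ℕ) : ℤ))) := by
  have : Finset.Icc (-((n + 1 : ℕ) : ℤ)) ((n + 1 : ℕ) : ℤ)
      = insert ((n + 1 : ℕ) : ℤ) (insert (-((n + 1 : ℕ) : ℤ)) (Finset.Icc (-(n : ℤ)) (n : ℤ))) := by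
    ext k; simp only [Finset.mem_Icc, Finset.mem_insert]; omega
  rw [this, Finset.sum_insert, Finset.sum_insert]
  · ring
  · simp
  · simp only [Finset.mem_Icc, Finset.mem_insert]; omega

theorem gauss_finite {q : ℂ} (hq : ‖q‖ < 1) (n : ℕ) :
    PP q n * ∑ j ∈ Finset.range (n + 1), (-1) ^ j * UU q j * q ^ (j * (n + 1))
      = ∑ k ∈ Finset.Icc (-(n : ℤ)) (n : ℤ), (-q) ^ (k.natAbs ^ 2) := by
  induction n with
  | zero => simp [PP, UU]; norm_num
  | succ n ih =>
    rw [Icc_step, ← ih]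
    have ht := tele hq n (n + 1)
    have h2 := one_add_ne hq n
    have hP := PP_succ hq n
    have hU : UU q (n + 1) * (PP q (n + 1) * (1 + q ^ (n + 1))) = 2 := by
      unfold UU
      exact div_mul_cancel₀ _ (mul_ne_zero (PP_ne hq _) h2)
    rw [Finset.sum_range_succ]
    have e1 : q ^ ((n + 1) * (n + 1 + 1)) = q ^ ((n + 1) * (n + 1)) * q ^ (n + 1) := by
      rw [← pow_add]; ring_nf
    have e0 : (-q) ^ ((n + 1) ^ 2) = (-1) ^ (n + 1) * q ^ ((n + 1) * (n + 1)) := by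
      rw [neg_pow, pow_two]
      congr 1
      rw [pow_mul]
      rcases Nat.even_or_odd (n + 1) with h | h
      · simp [h.neg_one_pow]
      · simp [h.neg_one_pow]
    have e3 : PP q n / (1 + q ^ (n + 1)) * ((-1) ^ (n + 1) * UU q (n + 1) * (1 - q ^ (n + 1))
        * q ^ ((n + 1) * (n + 1))) = PP q (n + 1) * (-1) ^ (n + 1) * UU q (n + 1)
        * q ^ ((n + 1) * (n + 1)) := by
      rw [div_mul_eq_mul_div, div_eq_iff h2]
      linear_combination (-((-1) ^ (n + 1) * UU q (n + 1) * q ^ ((n + 1) * (n + 1)))) * hP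
    rw [e3] at ht
    rw [Int.natAbs_neg, Int.natAbs_natCast, e0, e1]
    linear_combination ht + ((-1) ^ (n + 1) * q ^ ((n + 1) * (n + 1))) * hU

open Filter Topology in
theorem gauss {q : ℂ} (hq : ‖q‖ < 1) : phiNeg q = TT (-q) := by
  have hq2 := npow_lt hq (m := 2) (by norm_num)
  have hPt : Tendsto (PP q) atTop (𝓝 (phiNeg q)) :=
    ((E_hasProd hq).tendsto_prod_nat.pow 2).div (E_hasProd hq2).tendsto_prod_nat (E_ne hq2)
  have hqt : Tendsto (fun n : ℕ => 1 + q ^ n) atTop (𝓝 (1 + 0)) :=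
    (tendsto_pow_atTop_nhds_zero_of_norm_lt_one hq).const_add 1
  have hUt : Tendsto (UU q) atTop (𝓝 (2 / (phiNeg q * (1 + 0)))) :=
    tendsto_const_nhds.div (hPt.mul hqt) (by simpa using phiNeg_ne hq)
  obtain ⟨M, hM⟩ := (Metric.isBounded_range_of_tendsto _ hUt).exists_norm_le
  have hM' : ∀ n, ‖UU q n‖ ≤ M := fun n => hM _ ⟨n, rfl⟩
  have hM0 : 0 ≤ M := (norm_nonneg _).trans (hM' 0)
  set r := ‖q‖ with hr
  have hr0 : 0 ≤ r := norm_nonneg _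
  have hsmall : Tendsto (fun n : ℕ => ∑ j ∈ Finset.range n,
      (-1 : ℂ) ^ (j + 1) * UU q (j + 1) * q ^ ((j + 1) * (n + 1))) atTop (𝓝 0) := by
    refine squeeze_zero_norm (a := fun n : ℕ => r ^ n * (M * (1 - r)⁻¹)) (fun n => ?_) ?_
    · calc _ ≤ ∑ j ∈ Finset.range n, r ^ n * (M * r ^ j) := by
            refine norm_sum_le_of_le _ fun j _ => ?_
            rw [norm_mul, norm_mul, norm_pow, norm_pow, norm_neg, norm_one, one_pow, one_mul, ← hr]
            have : r ^ ((j + 1) * (n + 1)) ≤ r ^ (n + j) :=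
              pow_le_pow_of_le_one hr0 hq.le (by nlinarith [Nat.zero_le (j * n)])
            calc _ ≤ M * r ^ (n + j) := mul_le_mul (hM' _) this (by positivity) hM0
              _ = _ := by rw [pow_add]; ring
        _ = r ^ n * (M * ∑ j ∈ Finset.range n, r ^ j) := by
            rw [← Finset.mul_sum, ← Finset.mul_sum]
        _ ≤ _ := by
            have : ∑ j ∈ Finset.range n, r ^ j ≤ (1 - r)⁻¹ := by
              rw [← tsum_geometric_of_lt_one hr0 hq]
              exact (summable_geometric_of_lt_one hr0 hq).sum_le_tsum _ (fun _ _ => by positivity)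
            gcongr
    · simpa using (tendsto_pow_atTop_nhds_zero_of_lt_one hr0 hq).mul_const (M * (1 - r)⁻¹)
  have hfin : Tendsto (fun n : ℕ => PP q n * ∑ j ∈ Finset.range (n + 1),
      (-1) ^ j * UU q j * q ^ (j * (n + 1))) atTop (𝓝 (phiNeg q)) := by
    have := hPt.mul (hsmall.add_const 1)
    rw [zero_add, mul_one] at this
    refine this.congr fun n => ?_
    rw [Finset.sum_range_succ']
    have : UU q 0 = 1 := by simp [UU, PP]; norm_num
    simp [this]
  have hq' : ‖-q‖ < 1 := by simpa using hq
  have hT : Tendsto (fun n : ℕ => ∑ k ∈ Finset.Icc (-(n : ℤ)) (n : ℤ), (-q) ^ (k.natAbs ^ 2))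
      atTop (𝓝 (TT (-q))) :=
    (summ_TT hq').of_norm.hasSum.comp Finset.tendsto_Icc_neg
  refine tendsto_nhds_unique hfin (hT.congr fun n => (gauss_finite hq n).symm)

/-- part of the theta term with `n² ≡ r (mod 5)` -/
noncomputable def tt (r : ℤ) (x : ℂ) (n : ℤ) : ℂ := if n ^ 2 % 5 = r then x ^ (n.natAbs ^ 2) else 0

noncomputable def SS (r : ℤ) (x : ℂ) : ℂ := ∑' n : ℤ, tt r x n

theorem summ_tt {x : ℂ} (hx : ‖x‖ < 1) (r : ℤ) : Summable (fun n : ℤ => ‖tt r x n‖) := by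
  refine Summable.of_nonneg_of_le (fun _ => norm_nonneg _) (fun n => ?_) (summ_TT hx)
  unfold tt
  split_ifs
  · exact le_rfl
  · simp

theorem hasSum_tt {x : ℂ} (hx : ‖x‖ < 1) (r : ℤ) : HasSum (tt r x) (SS r x) :=
  (summ_tt hx r).of_norm.hasSum

theorem hasSum_TT {x : ℂ} (hx : ‖x‖ < 1) : HasSum (fun n : ℤ => x ^ (n.natAbs ^ 2)) (TT x) :=
  (summ_TT hx).of_norm.hasSum

theorem hasSum_mul2 {f g : ℤ → ℂ} {a b : ℂ} (hf : Summable fun n => ‖f n‖)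
    (hg : Summable fun n => ‖g n‖) (ha : HasSum f a) (hb : HasSum g b) :
    HasSum (fun p : ℤ × ℤ => f p.1 * g p.2) (a * b) :=
  ha.mul hb (summable_mul_of_summable_norm hf hg)

theorem sq_mod5 (n : ℤ) : (n ^ 2 % 5 = 0 ∧ n % 5 = 0) ∨
    (n ^ 2 % 5 = 1 ∧ (n % 5 = 1 ∨ n % 5 = 4)) ∨ (n ^ 2 % 5 = 4 ∧ (n % 5 = 2 ∨ n % 5 = 3)) := by
  have h : n % 5 = 0 ∨ n % 5 = 1 ∨ n % 5 = 2 ∨ n % 5 = 3 ∨ n % 5 = 4 := by omega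
  rcases h with h | h | h | h | h <;> simp [pow_two, Int.mul_emod, h]

theorem SS_zero {x : ℂ} (hx : ‖x‖ < 1) : SS 0 x = TT (x ^ 25) := by
  have h25 := hasSum_TT (npow_lt hx (m := 25) (by norm_num))
  have hinj : Function.Injective (fun n : ℤ => 5 * n) := fun a b h => by simpa using h
  refine (hasSum_tt hx 0).unique ?_
  rw [← hinj.hasSum_iff]
  · refine h25.congr_fun fun n => ?_
    have h1 : (5 * n) ^ 2 % 5 = 0 := by
      rcases sq_mod5 (5 * n) with h | h | h <;> omega
    have h2 : (5 * n).natAbs = 5 * n.natAbs := by simp [Int.natAbs_mul]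
    simp only [Function.comp, tt, h1, if_true, h2]
    rw [← pow_mul]; ring_nf
  · intro n hn
    have : ¬ n ^ 2 % 5 = 0 := by
      intro h
      rcases sq_mod5 n with h' | h' | h'
      · exact hn ⟨n / 5, by simp only; omega⟩
      · omega
      · omega
    simp [tt, this]

theorem TT_root {x z : ℂ} (hx : ‖x‖ < 1) (hz : z ^ 5 = 1) :
    TT (z * x) = SS 0 x + z * SS 1 x + z ^ 4 * SS 4 x := by
  have h := ((hasSum_tt hx 0).add ((hasSum_tt hx 1).mul_left z)).add
    ((hasSum_tt hx 4).mul_left (z ^ 4))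
  rw [← h.tsum_eq]
  unfold TT
  congr 1
  funext n
  have hn : ((n.natAbs ^ 2 : ℕ) : ℤ) = n ^ 2 := by simp
  have hzp : ∀ r : ℕ, n.natAbs ^ 2 % 5 = r → z ^ (n.natAbs ^ 2) = z ^ r := by
    intro r hr
    rw [← Nat.div_add_mod (n.natAbs ^ 2) 5, pow_add, pow_mul, hz, hr]; simp
  rw [mul_pow]
  rcases sq_mod5 n with ⟨h, -⟩ | ⟨h, -⟩ | ⟨h, -⟩
  · rw [hzp 0 (by omega)]; simp [tt, h]
  · rw [hzp 1 (by omega)]; simp [tt, h]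
  · rw [hzp 4 (by omega)]; simp [tt, h]

theorem lattice_aux {x : ℂ} (hx : ‖x‖ < 1) (s : ℤ) (hs : s = 1 ∨ s = -1) :
    HasSum (fun p : ℤ × ℤ => if (p.2 - s * (2 * p.1)) % 5 = 0 then
      x ^ (p.1.natAbs ^ 2) * x ^ (p.2.natAbs ^ 2) else 0) (TT (x ^ 5) * TT (x ^ 5)) := by
  have hx5 := npow_lt hx (m := 5) (by norm_num)
  have h := hasSum_mul2 (summ_TT hx5) (summ_TT hx5) (hasSum_TT hx5) (hasSum_TT hx5)
  have hinj : Function.Injective (fun p : ℤ × ℤ => (p.1 - 2 * p.2, s * (2 * p.1 + p.2))) := by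
    rintro ⟨a, b⟩ ⟨c, d⟩ h
    simp only [Prod.mk.injEq] at h ⊢
    rcases hs with rfl | rfl <;> omega
  rw [← hinj.hasSum_iff]
  · refine h.congr_fun ?_
    rintro ⟨a, b⟩
    have h1 : (s * (2 * a + b) - s * (2 * (a - 2 * b))) % 5 = 0 := by
      rcases hs with rfl | rfl <;> omega
    simp only [Function.comp, h1, if_true]
    rw [← pow_mul, ← pow_mul, ← pow_add, ← pow_add]
    congr 1
    zify
    rcases hs with rfl | rfl <;> simp only [sq_abs] <;> ring
  · rintro ⟨a, b⟩ hn
    have : ¬ (b - s * (2 * a)) % 5 = 0 := by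
      intro h
      rcases hs with rfl | rfl
      · exact hn ⟨(a + 2 * ((b - 2 * a) / 5), (b - 2 * a) / 5), by
          simp only [Prod.mk.injEq]; omega⟩
      · exact hn ⟨(a + 2 * ((-b - 2 * a) / 5), (-b - 2 * a) / 5), by
          simp only [Prod.mk.injEq]; omega⟩
    simp [this]

theorem lattice {x : ℂ} (hx : ‖x‖ < 1) :
    SS 1 x * SS 4 x = TT (x ^ 5) ^ 2 - SS 0 x ^ 2 := by
  have h1 := (lattice_aux hx 1 (Or.inl rfl)).add (lattice_aux hx (-1) (Or.inr rfl))
  have m := fun r s => hasSum_mul2 (summ_tt hx r) (summ_tt hx s) (hasSum_tt hx r) (hasSum_tt hx s)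
  have h2 := (((m 0 0).add (m 0 0)).add (m 1 4)).add (m 4 1)
  have := h1.unique (h2.congr_fun ?_)
  · linear_combination (-1/2) * this
  · rintro ⟨a, b⟩
    simp only [tt]
    rcases sq_mod5 a with ⟨ha, ha'⟩ | ⟨ha, ha'⟩ | ⟨ha, ha'⟩ <;>
    rcases sq_mod5 b with ⟨hb, hb'⟩ | ⟨hb, hb'⟩ | ⟨hb, hb'⟩ <;>
    simp only [ha, hb]
    · rw [if_pos (by omega), if_pos (by omega)]; simp
    · rw [if_neg (by omega), if_neg (by omega)]; simp
    · rw [if_neg (by omega), if_neg (by omega)]; simp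
    · rw [if_neg (by omega), if_neg (by omega)]; simp
    · rw [if_neg (by omega), if_neg (by omega)]; simp
    · by_cases hc : (b - 1 * (2 * a)) % 5 = 0
      · rw [if_pos hc, if_neg (by omega)]; simp
      · rw [if_neg hc, if_pos (by omega)]; simp
    · rw [if_neg (by omega), if_neg (by omega)]; simp
    · by_cases hc : (b - 1 * (2 * a)) % 5 = 0
      · rw [if_pos hc, if_neg (by omega)]; simp
      · rw [if_neg hc, if_pos (by omega)]; simp
    · rw [if_neg (by omega), if_neg (by omega)]; simp

/-- the 5-dissection data of `phiNeg` -/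
theorem dissect {q : ℂ} (hq : ‖q‖ < 1) :
    ∃ B C : ℂ, B * C = phiNeg (q^5)^2 - phiNeg (q^25)^2 ∧
      ∀ z : ℂ, z^5 = 1 → phiNeg (z * q) = phiNeg (q^25) + z * B + z^4 * C := by
  have hq' : ‖-q‖ < 1 := by simpa using hq
  have g5 : phiNeg (q^5) = TT ((-q)^5) := by
    rw [gauss (npow_lt hq (by norm_num)), Odd.neg_pow (by decide)]
  have g25 : phiNeg (q^25) = SS 0 (-q) := by
    rw [SS_zero hq', gauss (npow_lt hq (by norm_num)), Odd.neg_pow (by decide)]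
  refine ⟨SS 1 (-q), SS 4 (-q), ?_, ?_⟩
  · rw [g5, g25]; exact lattice hq'
  · intro z hz
    have hz1 : ‖z‖ = 1 := Complex.norm_eq_one_of_pow_eq_one hz (by norm_num)
    rw [gauss (by simpa [hz1] using hq), g25, ← TT_root hq' hz]
    congr 1; ring

theorem exists_root5 {q : ℂ} (hq : ‖q‖ < 1) : ∃ p : ℂ, ‖p‖ < 1 ∧ p ^ 5 = q := by
  obtain ⟨p, hp⟩ := IsAlgClosed.exists_pow_nat_eq q (n := 5) (by norm_num)
  refine ⟨p, ?_, hp⟩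
  by_contra h
  have : 1 ≤ ‖p‖ ^ 5 := one_le_pow₀ (not_lt.1 h)
  rw [← norm_pow, hp] at this
  linarith

theorem rec5 (a : ℕ → ℤ)
    (ha : ∀ q : ℂ, ‖q‖ < 1 →
      ∑' n : ℕ, (a n : ℂ) * q ^ n = phiNeg (q ^ 5) ^ 5 / phiNeg q) (n : ℕ) :
    a (5 * (5 * n)) = 6 * a (5 * n) - 5 * a n := by
  obtain ⟨w, hw⟩ : ∃ w : ℂ, IsPrimitiveRoot w 5 := ⟨_, Complex.isPrimitiveRoot_exp 5 (by norm_num)⟩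
  have hw5 := hw.pow_eq_one
  have hg := geom_w hw
  have hwj : ∀ j : ℕ, (w^j)^5 = 1 := fun j => by rw [← pow_mul, mul_comm, pow_mul, hw5, one_pow]
  have hS0 : ∀ q : ℂ, ‖q‖ < 1 → Summable (fun n => (a n : ℂ) * q ^ n) := by
    intro q hq
    by_contra h
    have := ha q hq
    rw [tsum_eq_zero_of_not_summable h] at this
    exact div_ne_zero (pow_ne_zero _ (phiNeg_ne (npow_lt hq (by norm_num)))) (phiNeg_ne hq) this.symm
  have hw1 : ‖w‖ = 1 := hw.norm'_eq_one (by norm_num)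
  have hwn : ∀ (j : ℕ) {q : ℂ}, ‖q‖ < 1 → ‖w^j * q‖ < 1 := by
    intro j q hq; simpa [hw1] using hq
  have hwq5 : ∀ (j : ℕ) (q : ℂ), (w^j * q)^5 = q^5 := by
    intro j q; rw [mul_pow, hwj, one_mul]
  -- first section
  have hS1 : ∀ q : ℂ, ‖q‖ < 1 → HasSum (fun n => (a (5 * n) : ℂ) * q ^ n)
      (phiNeg q ^ 3 * phiNeg (q^5) - 5 * phiNeg q * phiNeg (q^5)^3
        + 5 * (phiNeg (q^5)^5 / phiNeg q)) := by
    intro q' hq'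
    obtain ⟨q, hq, rfl⟩ := exists_root5 hq'
    have h := section5 hw (fun n => (a n : ℂ)) hS0 q hq
    convert h using 1
    obtain ⟨B, C, hBC, hd⟩ := dissect hq
    have hF : ∀ j, ∑' n, (a n : ℂ) * (w^j * q)^n = phiNeg (q^5)^5 / phiNeg (w^j * q) := by
      intro j; rw [ha _ (hwn j hq), hwq5]
    simp only [hF]
    have hP := phi_prod hw hq
    have hn : ∀ j, phiNeg (w^j * q) ≠ 0 := fun j => phiNeg_ne (hwn j hq)
    have n5 := phiNeg_ne (npow_lt hq (m := 5) (by norm_num))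
    have n25 := phiNeg_ne (npow_lt hq (m := 25) (by norm_num))
    have he4 := alg_e4 w (phiNeg (q^25)) B C hg (phiNeg (w^0*q)) (phiNeg (w^1*q))
      (phiNeg (w^2*q)) (phiNeg (w^3*q)) (phiNeg (w^4*q))
      (by rw [hd _ (hwj 0)]; ring) (by rw [hd _ (hwj 1)]; ring) (hd _ (hwj 2)) (hd _ (hwj 3))
      (hd _ (hwj 4))
    rw [hBC] at he4
    simp only [Finset.sum_range_succ, Finset.prod_range_succ, Finset.sum_range_zero,
      Finset.prod_range_zero, zero_add, one_mul] at hP ⊢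
    rw [show (q^5)^5 = q^25 by ring]
    have n0 := hn 0
    have n1 := hn 1
    have n2 := hn 2
    have n3 := hn 3
    have n4 := hn 4
    generalize phiNeg (w^0*q) = y0 at *
    generalize phiNeg (w^1*q) = y1 at *
    generalize phiNeg (w^2*q) = y2 at *
    generalize phiNeg (w^3*q) = y3 at *
    generalize phiNeg (w^4*q) = y4 at *
    generalize phiNeg (q^5) = P at *
    generalize phiNeg (q^25) = A at *
    have hsum : P^5 / y0 + P^5 / y1 + P^5 / y2 + P^5 / y3 + P^5 / y4
      = P^5 * (y1 * y2 * y3 * y4 + y0 * y2 * y3 * y4 + y0 * y1 * y3 * y4 + y0 * y1 * y2 * y4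
        + y0 * y1 * y2 * y3) / (y0 * y1 * y2 * y3 * y4) := by
      field_simp
    rw [hsum, he4, hP]
    field_simp
    ring
  -- second section
  have hS2 : ∀ q : ℂ, ‖q‖ < 1 → HasSum (fun n => (a (5 * (5 * n)) : ℂ) * q ^ n)
      (6 * phiNeg q ^ 3 * phiNeg (q^5) - 5 * phiNeg q * phiNeg (q^5)^3
        - 5 * (phiNeg q ^ 3 * phiNeg (q^5)) + 5 * (phiNeg q ^ 3 * phiNeg (q^5) - 5 * phiNeg q * phiNeg (q^5)^3
        + 5 * (phiNeg (q^5)^5 / phiNeg q))) := by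
    intro q' hq'
    have hS1' := hS1 q' hq'
    obtain ⟨q, hq, rfl⟩ := exists_root5 hq'
    have h := section5 hw (fun n => (a (5 * n) : ℂ)) (fun q hq => (hS1 q hq).summable) q hq
    convert h using 1
    have h0 := (section5 hw (fun n => (a n : ℂ)) hS0 q hq).unique hS1'
    obtain ⟨B, C, hBC, hd⟩ := dissect hq
    have hF : ∀ j, ∑' n, (a (5 * n) : ℂ) * (w^j * q)^n = phiNeg (w^j * q) ^ 3 * phiNeg (q^5)
        - 5 * phiNeg (w^j * q) * phiNeg (q^5)^3 + 5 * ∑' n, (a n : ℂ) * (w^j * q)^n := by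
      intro j; rw [(hS1 _ (hwn j hq)).tsum_eq, hwq5, ha _ (hwn j hq), hwq5]
    simp only [hF]
    rw [← h0]
    have e1 := alg_e1 w (phiNeg (q^25)) B C hg
    have e3 := alg_p3 w (phiNeg (q^25)) B C hg
    rw [hBC] at e3
    have d0 : phiNeg (w^0*q) = phiNeg (q^25) + B + C := by rw [hd _ (hwj 0)]; ring
    have d1 : phiNeg (w^1*q) = phiNeg (q^25) + w * B + w^4 * C := by rw [hd _ (hwj 1)]; ring
    rw [← d0, ← d1, ← hd _ (hwj 2), ← hd _ (hwj 3), ← hd _ (hwj 4)] at e1 e3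
    simp only [Finset.sum_range_succ, Finset.sum_range_zero, zero_add]
    rw [show (q^5)^5 = q^25 by ring]
    generalize phiNeg (w^0*q) = y0 at *
    generalize phiNeg (w^1*q) = y1 at *
    generalize phiNeg (w^2*q) = y2 at *
    generalize phiNeg (w^3*q) = y3 at *
    generalize phiNeg (w^4*q) = y4 at *
    linear_combination (-(phiNeg (q^5)) / 5) * e3 + (phiNeg (q^5)^3) * e1
  have key := coeff_zero (fun n => (a (5 * (5 * n)) : ℂ) - 6 * (a (5 * n) : ℂ) + 5 * (a n : ℂ)) ?_ n
  · have : ((a (5 * (5 * n)) - 6 * a (5 * n) + 5 * a n : ℤ) : ℂ) = 0 := by push_cast; exact key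
    have := Int.cast_eq_zero.1 this
    linarith
  · intro q hq
    have h0 : HasSum (fun n => (a n : ℂ) * q ^ n) (phiNeg (q ^ 5) ^ 5 / phiNeg q) := by
      rw [← ha q hq]; exact (hS0 q hq).hasSum
    have h := ((hS2 q hq).sub ((hS1 q hq).mul_left 6)).add (h0.mul_left 5)
    have hz : ∀ u v z : ℂ, 6 * u - v - 5 * u + 5 * (u - v + 5 * z) - 6 * (u - v + 5 * z) + 5 * z = 0 :=
      fun u v z => by ring
    rw [mul_assoc 6 (phiNeg q ^ 3), hz] at h
    exact h.congr_fun fun n => by ring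

theorem stmt_7 (a : ℕ → ℤ)
    (ha : ∀ q : ℂ, ‖q‖ < 1 →
      ∑' n : ℕ, (a n : ℂ) * q ^ n = phiNeg (q ^ 5) ^ 5 / phiNeg q) :
    ∀ n : ℕ, ∀ k : ℕ, 2 ≤ k →
      a (5 ^ k * n) = ((5 ^ k - 1) / 4 : ℤ) * a (5 * n) - ((5 ^ k - 5) / 4 : ℤ) * a n := by
  intro n k _
  have hr : ∀ k, a (5 ^ (k + 2) * n) = 6 * a (5 ^ (k + 1) * n) - 5 * a (5 ^ k * n) := by
    intro k
    have := rec5 a ha (5 ^ k * n)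
    rw [show 5 ^ (k + 2) * n = 5 * (5 * (5 ^ k * n)) by ring,
      show 5 ^ (k + 1) * n = 5 * (5 ^ k * n) by ring]
    exact this
  have hd : ∀ k : ℕ, ∃ m : ℤ, (5 : ℤ) ^ k = 4 * m + 1 := by
    intro k
    induction k with
    | zero => exact ⟨0, by norm_num⟩
    | succ k ih =>
      obtain ⟨m, hm⟩ := ih
      exact ⟨5 * m + 1, by rw [pow_succ, hm]; ring⟩
  have main : ∀ k, (4 * a (5 ^ k * n) = (5 ^ k - 1) * a (5 * n) - (5 ^ k - 5) * a n) ∧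
      (4 * a (5 ^ (k + 1) * n) = (5 ^ (k + 1) - 1) * a (5 * n) - (5 ^ (k + 1) - 5) * a n) := by
    intro k
    induction k with
    | zero => constructor <;> norm_num
    | succ k ih =>
      refine ⟨ih.2, ?_⟩
      have := hr k
      rw [show k + 1 + 1 = k + 2 from rfl, this]
      have h1 := ih.1
      have h2 := ih.2
      simp only [pow_succ] at h1 h2 ⊢
      linear_combination 6 * h2 - 5 * h1
  obtain ⟨m, hm⟩ := hd k
  have h := (main k).1
  have e1 : ((5 : ℤ) ^ k - 1) / 4 = m := by omega
  have e2 : ((5 : ℤ) ^ k - 5) / 4 = m - 1 := by omega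
  rw [e1, e2]
  rw [hm] at h
  linarith
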